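/- Let α > 0, λ ∈ ℝ, K ≥ 1, let c_1, …, c_K ∈ [0,1] be pairwise distinct nodes, and fix integers 0 ≤ j < n. Suppose the weights b_1(n−j), …, b_K(n−j) satisfy Σ_{r=1}^{K} b_r(n−j) c_r^k = k! · h^α · R_{α,α,k}(n−j, 0, 1; h^α λ) for k = 0, 1, …, K−1. Let f : [t_j, t_{j+1}] → ℝ be continuous and let p be the unique polynomial of degree at most K−1 interpolating f at the points t_j + c_1 h, …, t_j + c_K h. Then T_{n,j}[f] = ∫_{t_j}^{t_{j+1}} e_{α,α}(t_n − s; λ) (f(s) − p(s)) ds. -/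

import Mathlib

open MeasureTheory Real

/-- Generalized Mittag–Leffler function `e_{α,β}(t; z)`. -/
noncomputable def mlE (α β t z : ℝ) : ℝ :=
  ∑' k : ℕ, (-z) ^ k * t ^ (α * (k : ℝ) + β - 1) / Real.Gamma (α * (k : ℝ) + β)

/-- The weighted integral `R_{α,β,r}(t, a, b; z)`. -/
noncomputable def Rml (α β r t a b z : ℝ) : ℝ :=
  (1 / Real.Gamma (r + 1)) * ∫ s in a..b, mlE α β (t - s) z * (s - a) ^ r

/-- The Gamma function dominates every exponential: `M ^ (s - 1) ≤ e ^ (M + 1) Γ(s)`. -/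
lemma rpow_le_exp_mul_Gamma {M s : ℝ} (hM : 0 < M) (hs : 1 ≤ s) :
    M ^ (s - 1) ≤ Real.exp (M + 1) * Real.Gamma s := by
  have hint := Real.GammaIntegral_convergent (s := s) (by linarith)
  have hsub : Set.Ioc M (M + 1) ⊆ Set.Ioi 0 := fun x hx => hM.trans hx.1
  have hmono : ∫ _ in Set.Ioc M (M + 1), Real.exp (-(M + 1)) * M ^ (s - 1) ≤
      ∫ x in Set.Ioc M (M + 1), Real.exp (-x) * x ^ (s - 1) := by
    refine setIntegral_mono_on (integrableOn_const (by simp)) (hint.mono_set hsub)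
      measurableSet_Ioc fun x hx => ?_
    gcongr
    exacts [hx.2, hx.1.le]
  have hle : ∫ x in Set.Ioc M (M + 1), Real.exp (-x) * x ^ (s - 1) ≤ Real.Gamma s := by
    rw [Real.Gamma_eq_integral (by linarith)]
    refine setIntegral_mono_set hint ?_ hsub.eventuallyLE
    filter_upwards [ae_restrict_mem measurableSet_Ioi] with x hx
    exact mul_nonneg (Real.exp_pos _).le (Real.rpow_nonneg (le_of_lt hx) _)
  have hconst : ∫ _ in Set.Ioc M (M + 1), Real.exp (-(M + 1)) * M ^ (s - 1) =
      Real.exp (-(M + 1)) * M ^ (s - 1) := by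
    simp
  calc M ^ (s - 1) = Real.exp (M + 1) * (Real.exp (-(M + 1)) * M ^ (s - 1)) := by
        rw [← mul_assoc, ← Real.exp_add]; simp
    _ ≤ Real.exp (M + 1) * Real.Gamma s := by
        gcongr
        exact hconst ▸ hmono.trans hle

lemma summable_pow_div_Gamma {α β : ℝ} (hα : 0 < α) (hβ : 0 < β) (y : ℝ) :
    Summable fun k : ℕ => y ^ k / Real.Gamma (α * k + β) := by
  set M : ℝ := (2 * |y| + 1) ^ α⁻¹ with hMdef
  have hy : 0 < 2 * |y| + 1 := by positivity
  have hM : 0 < M := Real.rpow_pos_of_pos hy _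
  have hMα : M ^ α = 2 * |y| + 1 := by
    rw [hMdef, ← Real.rpow_mul hy.le, inv_mul_cancel₀ hα.ne', Real.rpow_one]
  have hgeom : Summable fun k : ℕ =>
      Real.exp (M + 1) * M ^ (1 - β) * (|y| / (2 * |y| + 1)) ^ k := by
    refine (summable_geometric_of_lt_one (by positivity) ?_).mul_left _
    rw [div_lt_one hy]
    linarith [abs_nonneg y]
  refine hgeom.of_norm_bounded_eventually_nat ?_
  have hlarge : ∀ᶠ k : ℕ in Filter.atTop, 1 ≤ α * (k : ℝ) + β := by
    filter_upwards [Filter.eventually_ge_atTop ⌈α⁻¹⌉₊] with k hk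
    have h1 : α⁻¹ ≤ k := Nat.ceil_le.mp hk
    have h2 : 1 ≤ α * (k : ℝ) := by
      rw [inv_le_iff_one_le_mul₀ hα] at h1
      linarith
    linarith
  filter_upwards [hlarge] with k hk
  have hΓ : 0 < Real.Gamma (α * k + β) := Real.Gamma_pos_of_pos (by linarith)
  rw [norm_div, norm_pow, Real.norm_eq_abs, Real.norm_eq_abs, abs_of_pos hΓ, div_le_iff₀ hΓ]
  have hsplit : M ^ (α * (k : ℝ) + β - 1) * M ^ (1 - β) = (2 * |y| + 1) ^ k := by
    rw [← Real.rpow_add hM, show α * (k : ℝ) + β - 1 + (1 - β) = α * k by ring,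
      Real.rpow_mul hM.le, hMα, Real.rpow_natCast]
  calc |y| ^ k = (|y| / (2 * |y| + 1)) ^ k * (2 * |y| + 1) ^ k := by
        rw [← mul_pow, div_mul_cancel₀ _ hy.ne']
    _ = (|y| / (2 * |y| + 1)) ^ k * (M ^ (α * (k : ℝ) + β - 1) * M ^ (1 - β)) := by rw [hsplit]
    _ ≤ (|y| / (2 * |y| + 1)) ^ k *
          ((Real.exp (M + 1) * Real.Gamma (α * k + β)) * M ^ (1 - β)) := by
        gcongr
        exact rpow_le_exp_mul_Gamma hM hk
    _ = _ := by ring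

lemma continuous_tsum_pow_div_Gamma {α β : ℝ} (hα : 0 < α) (hβ : 0 < β) :
    Continuous fun x : ℝ => ∑' k : ℕ, x ^ k / Real.Gamma (α * k + β) := by
  have hΓ (k : ℕ) : 0 < Real.Gamma (α * k + β) := Real.Gamma_pos_of_pos (by positivity)
  rw [continuous_iff_continuousAt]
  intro x
  have hcont : ContinuousOn (fun x : ℝ => ∑' k : ℕ, x ^ k / Real.Gamma (α * k + β))
      (Metric.closedBall 0 (|x| + 1)) := by
    refine continuousOn_tsum (fun k => by fun_prop)
      (summable_pow_div_Gamma hα hβ (|x| + 1)) fun k y hy => ?_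
    rw [norm_div, norm_pow, Real.norm_eq_abs (Real.Gamma _), abs_of_pos (hΓ k)]
    have := hΓ k
    gcongr
    simpa using hy
  refine hcont.continuousAt (Metric.closedBall_mem_nhds_of_mem ?_)
  simp

lemma mlE_eq_rpow_mul_tsum {α β t : ℝ} (ht : 0 < t) (z : ℝ) :
    mlE α β t z =
      t ^ (β - 1) * ∑' k : ℕ, (-z * t ^ α) ^ k / Real.Gamma (α * k + β) := by
  rw [mlE, ← tsum_mul_left]
  congr 1 with k
  rw [show α * (k : ℝ) + β - 1 = β - 1 + α * k by ring, Real.rpow_add ht,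
    Real.rpow_mul ht.le, Real.rpow_natCast, mul_pow]
  ring

lemma intervalIntegrable_mlE {α β : ℝ} (hα : 0 < α) (hβ : 0 < β) (z : ℝ) {a b : ℝ}
    (ha : 0 ≤ a) (hb : 0 ≤ b) :
    IntervalIntegrable (fun t => mlE α β t z) volume a b := by
  have hcont : Continuous fun t : ℝ =>
      ∑' k : ℕ, (-z * t ^ α) ^ k / Real.Gamma (α * k + β) :=
    (continuous_tsum_pow_div_Gamma hα hβ).comp
      (continuous_const.mul (Real.continuous_rpow_const hα.le))
  refine ((intervalIntegral.intervalIntegrable_rpow' (by linarith : -1 < β - 1)).mul_continuousOn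
    hcont.continuousOn).congr ?_
  intro t ht
  exact (mlE_eq_rpow_mul_tsum ((le_min ha hb).trans_lt ht.1) z).symm

lemma intervalIntegrable_mlE_sub {α β : ℝ} (hα : 0 < α) (hβ : 0 < β) (z : ℝ) {t a b : ℝ}
    (ha : a ≤ t) (hb : b ≤ t) :
    IntervalIntegrable (fun s => mlE α β (t - s) z) volume a b := by
  simpa using (intervalIntegrable_mlE hα hβ z (sub_nonneg.2 ha) (sub_nonneg.2 hb)).comp_sub_left t

lemma mlE_mul {α β h t : ℝ} (hh : 0 < h) (ht : 0 ≤ t) (z : ℝ) :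
    mlE α β (h * t) z = h ^ (β - 1) * mlE α β t (h ^ α * z) := by
  rw [mlE, mlE, ← tsum_mul_left]
  congr 1 with k
  rw [Real.mul_rpow hh.le ht, show α * (k : ℝ) + β - 1 = β - 1 + α * k by ring,
    Real.rpow_add hh, Real.rpow_mul hh.le, Real.rpow_natCast, ← mul_neg, mul_pow]
  ring

lemma Rml_natCast (α β t z : ℝ) (k : ℕ) :
    (k.factorial : ℝ) * Rml α β k t 0 1 z = ∫ s in (0 : ℝ)..1, mlE α β (t - s) z * s ^ k := by
  have hk : (k.factorial : ℝ) ≠ 0 := by positivity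
  simp only [Rml, Real.Gamma_nat_eq_factorial, sub_zero, Real.rpow_natCast]
  rw [← mul_assoc, mul_one_div_cancel hk, one_mul]

/-- Rescaling of a convolution integral with Mittag–Leffler kernel to the unit interval. -/
lemma integral_mlE_mul_eq {α β h a t : ℝ} (hh : 0 < h) (ht : 1 ≤ t) (z : ℝ) (g : ℝ → ℝ) :
    ∫ s in a..a + h, mlE α β (a + h * t - s) z * g s =
      h ^ β * ∫ s in (0 : ℝ)..1, mlE α β (t - s) (h ^ α * z) * g (a + h * s) := by
  have hsubst := intervalIntegral.mul_integral_comp_add_mul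
    (f := fun s => mlE α β (a + h * t - s) z * g s) h a (a := 0) (b := 1)
  simp only [mul_zero, add_zero, mul_one] at hsubst
  rw [← hsubst, ← intervalIntegral.integral_const_mul, ← intervalIntegral.integral_const_mul]
  refine intervalIntegral.integral_congr fun s hs => ?_
  rw [Set.uIcc_of_le zero_le_one] at hs
  have hpow : h * h ^ (β - 1) = h ^ β := by
    rw [Real.rpow_sub_one hh.ne', mul_div_cancel₀ _ hh.ne']
  rw [show a + h * t - (a + h * s) = h * (t - s) by ring,
    mlE_mul hh (sub_nonneg.2 (hs.2.trans ht)), ← hpow]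
  ring

/-- Weights matching the monomial moments of degree `< K` integrate every polynomial of degree
`< K` against the kernel exactly. -/
lemma integral_mlE_mul_eval_eq_sum {α β t z C : ℝ} (hα : 0 < α) (hβ : 0 < β) (ht : 1 ≤ t)
    {ι : Type*} [Fintype ι] {K : ℕ} {w c : ι → ℝ}
    (hw : ∀ k < K, ∑ r, w r * c r ^ k = C * ((k.factorial : ℝ) * Rml α β k t 0 1 z))
    {q : Polynomial ℝ} (hq : q.natDegree < K) :
    C * ∫ s in (0 : ℝ)..1, mlE α β (t - s) z * q.eval s = ∑ r, w r * q.eval (c r) := by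
  have heval (x : ℝ) : q.eval x = ∑ k ∈ Finset.range K, q.coeff k * x ^ k :=
    Polynomial.eval_eq_sum_range' hq x
  have hkernel := intervalIntegrable_mlE_sub hα hβ z (zero_le_one.trans ht) ht
  simp only [heval, Finset.mul_sum]
  rw [intervalIntegral.integral_finsetSum
    fun k _ => hkernel.mul_continuousOn (by fun_prop), Finset.mul_sum, Finset.sum_comm]
  refine Finset.sum_congr rfl fun k hk => ?_
  simp only [mul_left_comm _ (q.coeff k), intervalIntegral.integral_const_mul]
  rw [← Rml_natCast, ← hw k (Finset.mem_range.1 hk), Finset.mul_sum]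

theorem remainder_eq_interpolation_error (α lam t0 h : ℝ) (hα : 0 < α) (hh : 0 < h)
    (K : ℕ) (hK : 1 ≤ K) (c : Fin K → ℝ) (hc : ∀ r, c r ∈ Set.Icc (0 : ℝ) 1)
    (hdist : Function.Injective c) (b : Fin K → ℕ → ℝ) (n j : ℕ) (hjn : j < n)
    (horder : ∀ k < K,
      ∑ r, b r (n - j) * c r ^ k
        = (k.factorial : ℝ) * h ^ α
            * Rml α α k ((n : ℝ) - (j : ℝ)) 0 1 (h ^ α * lam))
    (f : ℝ → ℝ)
    (hfc : ContinuousOn f (Set.Icc (t0 + (j : ℝ) * h) (t0 + ((j : ℝ) + 1) * h)))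
    (p : Polynomial ℝ) (hdeg : p.degree < (K : ℕ))
    (hinterp : ∀ r, p.eval (t0 + (j : ℝ) * h + c r * h)
      = f (t0 + (j : ℝ) * h + c r * h)) :
    (∫ s in (t0 + (j : ℝ) * h)..(t0 + ((j : ℝ) + 1) * h),
        mlE α α (t0 + (n : ℝ) * h - s) lam * f s)
      - ∑ r, b r (n - j) * f (t0 + (j : ℝ) * h + c r * h)
      = ∫ s in (t0 + (j : ℝ) * h)..(t0 + ((j : ℝ) + 1) * h),
          mlE α α (t0 + (n : ℝ) * h - s) lam * (f s - p.eval s) := by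
  have hright : t0 + ((j : ℝ) + 1) * h = t0 + (j : ℝ) * h + h := by ring
  have hend : t0 + (n : ℝ) * h = t0 + (j : ℝ) * h + h * ((n : ℝ) - j) := by ring
  rw [hright] at hfc ⊢
  rw [hend]
  set a := t0 + (j : ℝ) * h
  have ht : (1 : ℝ) ≤ (n : ℝ) - j := by
    have : (j : ℝ) + 1 ≤ n := by exact_mod_cast hjn
    linarith
  have hle : a + h ≤ a + h * ((n : ℝ) - j) := by
    linarith [le_mul_of_one_le_right hh.le ht]
  have hkernel := intervalIntegrable_mlE_sub hα hα lam ((le_add_of_nonneg_right hh.le).trans hle) hle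
  rw [← Set.uIcc_of_le (le_add_of_nonneg_right hh.le)] at hfc
  simp only [mul_sub (mlE _ _ _ _)]
  rw [intervalIntegral.integral_sub (hkernel.mul_continuousOn hfc)
    (hkernel.mul_continuousOn p.continuous.continuousOn), sub_right_inj]
  set q : Polynomial ℝ := p.comp (Polynomial.C h * Polynomial.X + Polynomial.C a)
  have hq : q.natDegree < K := by
    rw [Polynomial.natDegree_comp, Polynomial.natDegree_linear hh.ne', mul_one]
    rcases eq_or_ne p 0 with rfl | hp
    · simpa using Nat.lt_of_succ_le hK
    · exact (Polynomial.natDegree_lt_iff_degree_lt hp).2 hdeg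
  have hqeval (x : ℝ) : q.eval x = p.eval (a + h * x) := by simp [q, add_comm]
  have hexact := integral_mlE_mul_eval_eq_sum (w := fun r => b r (n - j)) (c := c)
    (C := h ^ α) hα hα ht (fun k hk => (horder k hk).trans (by ring)) hq
  rw [integral_mlE_mul_eq hh ht]
  simp only [hqeval] at hexact
  rw [hexact]
  exact Finset.sum_congr rfl fun r _ => by rw [← hinterp, mul_comm h]
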